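/- For all graphs G and H, the corona product satisfies Z(G ∘ H) ≤ Z(G) + |V(G)|·Z(H). -/

import Mathlib

open SimpleGraph

variable {V : Type*} {α β : Type*}

/-- Vertices forced black starting from `B`. -/
inductive ZFClosure (G : SimpleGraph V) (B : Set V) : V → Prop
  | init {v : V} : v ∈ B → ZFClosure G B v
  | force {u v : V} : ZFClosure G B u → G.Adj u v →
      (∀ w, G.Adj u w → w ≠ v → ZFClosure G B w) → ZFClosure G B v

/-- `B` is a zero forcing set of `G`. -/
def IsZFS (G : SimpleGraph V) (B : Set V) : Prop := ∀ v : V, ZFClosure G B v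

/-- `B` is a connected zero forcing set of `G`. -/
def IsCZFS (G : SimpleGraph V) (B : Set V) : Prop :=
  IsZFS G B ∧ ∀ C : G.ConnectedComponent, (G.induce (B ∩ C.supp)).Connected

/-- The zero forcing number `Z(G)`. -/
noncomputable def zfNum (G : SimpleGraph V) : ℕ :=
  sInf {k | ∃ B : Set V, B.ncard = k ∧ IsZFS G B}

/-- The connected zero forcing number `Z_c(G)`. -/
noncomputable def czfNum (G : SimpleGraph V) : ℕ :=
  sInf {k | ∃ B : Set V, B.ncard = k ∧ IsCZFS G B}

/-- One step of the color change rule. -/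
def zfStep (G : SimpleGraph V) (S : Set V) : Set V :=
  S ∪ {w | ∃ b ∈ S, G.Adj b w ∧ ∀ x, G.Adj b x → x ∉ S → x = w}

/-- propagation time of `B` in `G`. -/
noncomputable def propTime (G : SimpleGraph V) (B : Set V) : ℕ :=
  sInf {t | (zfStep G)^[t] B = Set.univ}

/-- minimum connected propagation time. -/
noncomputable def minCPT (G : SimpleGraph V) : ℕ :=
  sInf {t | ∃ B : Set V, IsCZFS G B ∧ B.ncard = czfNum G ∧ propTime G B = t}

/-- maximum connected propagation time. -/
noncomputable def maxCPT (G : SimpleGraph V) : ℕ :=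
  sSup {t | ∃ B : Set V, IsCZFS G B ∧ B.ncard = czfNum G ∧ propTime G B = t}

/-- Strong product of graphs. -/
def StrongProd (G : SimpleGraph α) (H : SimpleGraph β) : SimpleGraph (α × β) :=
  SimpleGraph.fromRel (fun a b =>
    (a.1 = b.1 ∧ H.Adj a.2 b.2) ∨ (a.2 = b.2 ∧ G.Adj a.1 b.1) ∨
      (G.Adj a.1 b.1 ∧ H.Adj a.2 b.2))

/-- Corona product of graphs. -/
def Corona (G : SimpleGraph α) (H : SimpleGraph β) : SimpleGraph (α ⊕ α × β) :=
  SimpleGraph.fromRel (fun a b =>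
    match a, b with
    | .inl u, .inl v => G.Adj u v
    | .inl u, .inr (v, _) => u = v
    | .inr (u, w), .inr (v, w') => u = v ∧ H.Adj w w'
    | _, _ => False)

/-- Generalized corona. -/
def GenCorona {n : ℕ} {W : Fin n → Type*} (G : SimpleGraph (Fin n))
    (H : ∀ i, SimpleGraph (W i)) : SimpleGraph (Fin n ⊕ Σ i, W i) :=
  SimpleGraph.fromRel (fun a b =>
    match a, b with
    | .inl i, .inl j => G.Adj i j
    | .inl i, .inr ⟨j, _⟩ => i = j
    | .inr ⟨i, w⟩, .inr ⟨j, w'⟩ => ∃ h : i = j, (H j).Adj (h ▸ w) w'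
    | _, _ => False)

/-- Wheel graph with hub `none` and rim a cycle on `m` vertices. -/
def WheelGraph (m : ℕ) : SimpleGraph (Option (Fin m)) :=
  SimpleGraph.fromRel (fun a b =>
    a = none ∨ ∃ i j, a = some i ∧ b = some j ∧ (cycleGraph m).Adj i j)

theorem exists_isZFS_ncard_eq_zfNum (G : SimpleGraph V) :
    ∃ B : Set V, B.ncard = zfNum G ∧ IsZFS G B :=
  Nat.sInf_mem (s := {k | ∃ B : Set V, B.ncard = k ∧ IsZFS G B})
    ⟨_, Set.univ, rfl, fun _ => .init (Set.mem_univ _)⟩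

theorem zfNum_le_ncard {G : SimpleGraph V} {B : Set V} (hB : IsZFS G B) :
    zfNum G ≤ B.ncard :=
  Nat.sInf_le ⟨B, rfl, hB⟩

theorem corona_adj_inl_inl {G : SimpleGraph α} {H : SimpleGraph β} {u v : α} :
    (Corona G H).Adj (.inl u) (.inl v) ↔ G.Adj u v := by
  simp only [Corona, SimpleGraph.fromRel_adj, G.adj_comm v u, or_self, ne_eq, Sum.inl.injEq,
    and_iff_right_iff_imp]
  exact fun h => h.ne

theorem corona_adj_inl_inr {G : SimpleGraph α} {H : SimpleGraph β} {u v : α} {w : β} :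
    (Corona G H).Adj (.inl u) (.inr (v, w)) ↔ u = v := by
  simp [Corona, SimpleGraph.fromRel_adj]

theorem corona_adj_inr_inr {G : SimpleGraph α} {H : SimpleGraph β} {u v : α} {w x : β} :
    (Corona G H).Adj (.inr (u, w)) (.inr (v, x)) ↔ u = v ∧ H.Adj w x := by
  simp only [Corona, SimpleGraph.fromRel_adj, H.adj_comm x w, eq_comm (a := v), or_self, ne_eq,
    Sum.inr.injEq, Prod.mk.injEq, and_iff_right_iff_imp]
  exact fun h e => h.2.ne e.2

/-- Once the `i`-th vertex of `G` is black, zero forcing runs in the `i`-th copy of `H`. -/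
theorem ZFClosure.corona_inr {G : SimpleGraph α} {H : SimpleGraph β} {S : Set (α ⊕ α × β)}
    {B : Set β} {i : α} (hS : ∀ w ∈ B, Sum.inr (i, w) ∈ S)
    (hi : ZFClosure (Corona G H) S (.inl i)) {w : β} (hw : ZFClosure H B w) :
    ZFClosure (Corona G H) S (.inr (i, w)) := by
  induction hw with
  | init h => exact .init (hS _ h)
  | @force u v _ huv _ ihu ih =>
    refine .force ihu (corona_adj_inr_inr.2 ⟨rfl, huv⟩) ?_
    rintro (j | ⟨j, x⟩) hadj hne
    · rw [SimpleGraph.adj_comm, corona_adj_inl_inr] at hadj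
      exact hadj ▸ hi
    · obtain ⟨rfl, hux⟩ := corona_adj_inr_inr.1 hadj
      exact ih x hux fun h => hne (h ▸ rfl)

/-- A zero forcing set of `G` together with a zero forcing set in each copy of `H` forces every
vertex of `G` in the corona. -/
theorem ZFClosure.corona_inl {G : SimpleGraph α} {H : SimpleGraph β} {S : Set (α ⊕ α × β)}
    {A : Set α} {B : Set β} (hA : ∀ a ∈ A, Sum.inl a ∈ S)
    (hS : ∀ i, ∀ w ∈ B, Sum.inr (i, w) ∈ S) (hB : IsZFS H B) {v : α} (hv : ZFClosure G A v) :
    ZFClosure (Corona G H) S (.inl v) := by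
  induction hv with
  | init h => exact .init (hA _ h)
  | @force u v _ huv _ ihu ih =>
    refine .force ihu (corona_adj_inl_inl.2 huv) ?_
    rintro (j | ⟨j, x⟩) hadj hne
    · exact ih j (corona_adj_inl_inl.1 hadj) fun h => hne (h ▸ rfl)
    · obtain rfl := corona_adj_inl_inr.1 hadj
      exact ihu.corona_inr (hS u) (hB x)

/-- `Z(G ∘ H) ≤ Z(G) + |V(G)|·Z(H)`. -/
theorem stmt13 {α β : Type*} [Fintype α] [Fintype β] [Nonempty α] [Nonempty β]
    (G : SimpleGraph α) (H : SimpleGraph β) :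
    zfNum (Corona G H) ≤ zfNum G + Fintype.card α * zfNum H := by
  obtain ⟨A, hAcard, hA⟩ := exists_isZFS_ncard_eq_zfNum G
  obtain ⟨B, hBcard, hB⟩ := exists_isZFS_ncard_eq_zfNum H
  let S : Set (α ⊕ α × β) := Sum.inl '' A ∪ Sum.inr '' (Set.univ ×ˢ B)
  have hSA : ∀ a ∈ A, Sum.inl a ∈ S := fun a ha => .inl ⟨a, ha, rfl⟩
  have hSB : ∀ i, ∀ w ∈ B, Sum.inr (i, w) ∈ S :=
    fun i w hw => .inr ⟨(i, w), ⟨Set.mem_univ i, hw⟩, rfl⟩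
  have hinl (v : α) : ZFClosure (Corona G H) S (.inl v) := (hA v).corona_inl hSA hSB hB
  have hS : IsZFS (Corona G H) S := by
    rintro (v | ⟨i, w⟩)
    · exact hinl v
    · exact (hinl i).corona_inr (hSB i) (hB w)
  calc zfNum (Corona G H) ≤ S.ncard := zfNum_le_ncard hS
    _ ≤ (Sum.inl '' A : Set (α ⊕ α × β)).ncard
        + (Sum.inr '' (Set.univ ×ˢ B) : Set (α ⊕ α × β)).ncard := Set.ncard_union_le _ _
    _ = zfNum G + Fintype.card α * zfNum H := by
      rw [Set.ncard_image_of_injective _ Sum.inl_injective,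
        Set.ncard_image_of_injective _ Sum.inr_injective, Set.ncard_prod, Set.ncard_univ,
        Nat.card_eq_fintype_card, hAcard, hBcard]
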